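/- For every α ∈ C̄ and every C(x)-vector-space basis {ω₁,…,ω_r} of A: {ω₁,…,ω_r} is a local integral basis of A at α if and only if {Sω₁,…,Sω_r} is a local integral basis of A at α − 1. -/

import Mathlib

set_option maxHeartbeats 1000000
set_option synthInstance.maxHeartbeats 200000

open Polynomial Filter

noncomputable section

namespace PRec

variable (C : Type*) [Field C] [CharZero C]

/-- The algebraic closure of the coefficient field. -/
abbrev Cbar := AlgebraicClosure C

/-- The field of formal Laurent series over the algebraic closure. -/
abbrev LS := LaurentSeries (Cbar C)

/-- The Laurent-series variable `q`. -/
def qv : LS C := HahnSeries.single 1 1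

open Classical in
/-- The valuation `ν_q`, with `ν_q 0 = ⊤`, valued in the extended reals. -/
def nuq (a : LS C) : EReal := if a = 0 then ⊤ else (((a.order : ℤ) : ℝ) : EReal)

/-- Evaluation of a rational function at the point `α + m + q`. -/
def evalAt (α : Cbar C) (m : ℤ) (p : RatFunc C) : LS C :=
  RatFunc.eval ((algebraMap (Cbar C) (LS C)).comp (algebraMap C (Cbar C)))
    (algebraMap (Cbar C) (LS C) α + (m : LS C) + qv C) p

/-- Shorthand for the canonical map `C[x] → C(x)`. -/
abbrev toRat : Polynomial C →+* RatFunc C := algebraMap (Polynomial C) (RatFunc C)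

variable (ℓ : ℕ → Polynomial C) (r : ℕ)

/-- The solution space `Sol_α(L)` of `L = ℓ₀ + ℓ₁ S + ⋯ + ℓ_r S^r` at `α`,
indexed so that `b n` stands for the value of the solution at `α + n`. -/
def SolSet (α : Cbar C) : Set (ℤ → LS C) :=
  {b | ∀ n : ℤ, ∑ i ∈ Finset.range (r + 1),
      evalAt C α n (toRat C (ℓ i)) * b (n + i) = 0}

/-- The action of an element `f = f₀ + f₁ S + ⋯ + f_{r-1} S^{r-1}` of
`A = C(x)[S]/⟨L⟩` (represented by its coefficient vector) on a sequence. -/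
def elemApply (α : Cbar C) (f : Fin r → RatFunc C) (b : ℤ → LS C) : ℤ → LS C :=
  fun n => ∑ i : Fin r, evalAt C α n (f i) * b (n + (i : ℤ))

/-- Truncated subtraction on extended reals with the convention `⊤ - ⊤ = ⊤`. -/
def esub (a b : EReal) : EReal := if b = ⊤ then ⊤ else a - b

/-- The value function `val_α` on `A`. -/
def valAt (α : Cbar C) (f : Fin r → RatFunc C) : EReal :=
  ⨅ b ∈ SolSet C ℓ r α,
    esub (nuq C (elemApply C r α f b 0))
      (Filter.liminf (fun n : ℕ => nuq C (b (-(n : ℤ)))) Filter.atTop)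

/-- `f ∈ A` is (locally) integral at `α`. -/
def IntegralAt (α : Cbar C) (f : Fin r → RatFunc C) : Prop :=
  0 ≤ valAt C ℓ r α f

/-- Membership in the local subring `C(x)_α` of rational functions having no pole at `α`. -/
def InLocalRing (α : Cbar C) (f : RatFunc C) : Prop :=
  ∃ p q : Polynomial C, (Polynomial.aeval α) q ≠ 0 ∧ f = toRat C p / toRat C q

/-- `W` is a `C(x)`-vector space basis of `A` (represented on coefficient vectors). -/
def IsVSBasis (W : Fin r → (Fin r → RatFunc C)) : Prop :=
  LinearIndependent (RatFunc C) W ∧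
    Submodule.span (RatFunc C) (Set.range W) = (⊤ : Submodule (RatFunc C) (Fin r → RatFunc C))

/-- The `C(x)_α`-span of a tuple of elements of `A`. -/
def localSpan (α : Cbar C) (W : Fin r → (Fin r → RatFunc C)) :
    Set (Fin r → RatFunc C) :=
  {f | ∃ c : Fin r → RatFunc C, (∀ i, InLocalRing C α (c i)) ∧ f = ∑ i, c i • W i}

/-- `W` is a local integral basis of `A` at `α`. -/
def IsLocalIntegralBasis (α : Cbar C) (W : Fin r → (Fin r → RatFunc C)) : Prop :=
  IsVSBasis C r W ∧ (∀ i, IntegralAt C ℓ r α (W i)) ∧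
    ∀ f : Fin r → RatFunc C, IntegralAt C ℓ r α f → f ∈ localSpan C r α W

/-- The standard basis `1, S, …, S^{r-1}` of `A`. -/
def stdBasis : Fin r → (Fin r → RatFunc C) :=
  fun i j => if j = i then 1 else 0

/-- The shift automorphism `p(x) ↦ p(x+c)` of the polynomial ring. -/
def polyShiftEquiv (c : C) : Polynomial C ≃+* Polynomial C where
  toFun p := p.comp (X + Polynomial.C c)
  invFun p := p.comp (X - Polynomial.C c)
  left_inv p := by
    show (p.comp (X + Polynomial.C c)).comp (X - Polynomial.C c) = p
    rw [Polynomial.comp_assoc]; simp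
  right_inv p := by
    show (p.comp (X - Polynomial.C c)).comp (X + Polynomial.C c) = p
    rw [Polynomial.comp_assoc]; simp
  map_add' p q := by simp [Polynomial.add_comp]
  map_mul' p q := by simp [Polynomial.mul_comp]

/-- The shift `σ^k`, `p(x) ↦ p(x+k)`, on polynomials, for `k : ℤ`. -/
def polyShift (k : ℤ) (p : Polynomial C) : Polynomial C := polyShiftEquiv C (k : C) p

/-- `σ` on polynomials. -/
def polyσ : Polynomial C ≃+* Polynomial C := polyShiftEquiv C 1

/-- The shift automorphism `σ : f(x) ↦ f(x+1)` of the rational function field. -/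
def ratσ : RatFunc C →+* RatFunc C :=
  RatFunc.mapRingHom (polyσ C : Polynomial C →+* Polynomial C)
    (by
      intro p hp
      simp only [Submonoid.mem_comap]
      refine mem_nonZeroDivisors_iff_ne_zero.mpr ?_
      have hp0 : p ≠ 0 := mem_nonZeroDivisors_iff_ne_zero.mp hp
      simpa using (map_ne_zero_iff _ (polyσ C).injective).mpr hp0)

variable [NeZero r]

/-- The index `r - 1` as an element of `Fin r`. -/
def lastIdx : Fin r := ⟨r - 1, Nat.sub_lt (Nat.pos_of_ne_zero (NeZero.ne r)) one_pos⟩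

/-- The action of `S` on `A = C(x)[S]/⟨L⟩`, on coefficient vectors with respect to the
basis `1, S, …, S^{r-1}`, using `S^r = -(ℓ₀/ℓ_r) - ⋯ - (ℓ_{r-1}/ℓ_r) S^{r-1}`. -/
def Smap (f : Fin r → RatFunc C) : Fin r → RatFunc C :=
  fun j =>
    (if (j : ℕ) = 0 then 0 else
      ratσ C (f ⟨(j : ℕ) - 1, lt_of_le_of_lt (Nat.sub_le _ _) j.isLt⟩))
      - ratσ C (f (lastIdx r)) * (toRat C (ℓ j) / toRat C (ℓ r))

/-- The difference operator `Δ = S - 1` on `A`. -/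
def Dmap (f : Fin r → RatFunc C) : Fin r → RatFunc C :=
  Smap C ℓ r f - f

/-- `f ∈ A` is summable. -/
def IsSummable (f : Fin r → RatFunc C) : Prop :=
  ∃ g : Fin r → RatFunc C, f = Dmap C ℓ r g

/-- `disp_α(p) ≥ k`: `p` has two roots in `α + ℤ` at distance `k`. -/
def DispGe (α : Cbar C) (p : Polynomial (Cbar C)) (k : ℕ) : Prop :=
  ∃ m : ℤ, Polynomial.eval (α + (m : Cbar C)) p = 0 ∧
    Polynomial.eval (α + (m : Cbar C) + (k : Cbar C)) p = 0

/-- The dispersion `disp_α(p)` as an extended natural number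
(`0` by convention for the empty set, which is excluded by the hypotheses below). -/
def dispVal (α : Cbar C) (p : Polynomial (Cbar C)) : ℕ∞ :=
  sSup ((fun k : ℕ => (k : ℕ∞)) '' {k : ℕ | DispGe C α p k})

/-- A polynomial is shift-free if it is coprime to each of its nontrivial shifts. -/
def ShiftFree {K : Type*} [Field K] [CharZero K] (p : Polynomial K) : Prop :=
  ∀ k : ℤ, k ≠ 0 → IsCoprime p (p.comp (X + Polynomial.C (k : K)))

/-- The point `α + m + q`. -/
def evalPt (α : Cbar C) (m : ℤ) : LS C :=
  algebraMap (Cbar C) (LS C) α + (m : LS C) + qv C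

/-- The coefficient embedding of `C` into the Laurent series field. -/
abbrev coeffHom : C →+* LS C :=
  (algebraMap (Cbar C) (LS C)).comp (algebraMap C (Cbar C))

theorem algebraMap_add_qv_ne (a c : Cbar C) :
    algebraMap (Cbar C) (LS C) a + qv C ≠ algebraMap (Cbar C) (LS C) c := by
  intro h
  have h1 : qv C = algebraMap (Cbar C) (LS C) (c - a) := by
    rw [map_sub, ← h]; ring
  have h2 := congrArg (fun x : LS C => x.coeff 1) h1
  rw [LaurentSeries.algebraMap_apply] at h2
  simp [qv, HahnSeries.C_apply] at h2

theorem evalPt_eq (α : Cbar C) (m : ℤ) :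
    evalPt C α m = algebraMap (Cbar C) (LS C) (α + m) + qv C := by
  simp [evalPt]

theorem eval₂_evalPt_ne_zero (α : Cbar C) (m : ℤ) {p : Polynomial C} (hp : p ≠ 0) :
    p.eval₂ (coeffHom C) (evalPt C α m) ≠ 0 := by
  intro h
  rw [coeffHom, ← Polynomial.eval₂_map] at h
  have hint : IsIntegral (Cbar C) (evalPt C α m) := by
    refine IsAlgebraic.isIntegral ⟨p.map (algebraMap C (Cbar C)), ?_, h⟩
    exact (Polynomial.map_ne_zero_iff (algebraMap C (Cbar C)).injective).mpr hp
  obtain ⟨c, hc⟩ := minpoly.mem_range_of_degree_eq_one (Cbar C) _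
    (IsAlgClosed.degree_eq_one_of_irreducible _ (minpoly.irreducible hint))
  rw [evalPt_eq] at hc
  exact algebraMap_add_qv_ne C _ _ hc.symm

theorem evalAt_toRat (α : Cbar C) (m : ℤ) (p : Polynomial C) :
    evalAt C α m (toRat C p) = p.eval₂ (coeffHom C) (evalPt C α m) :=
  RatFunc.eval_algebraMap _ _ _

/-- Evaluation at `α + m + q` as a ring homomorphism. -/
def evalHom (α : Cbar C) (m : ℤ) : RatFunc C →+* LS C where
  toFun := evalAt C α m
  map_one' := RatFunc.eval_one _ _
  map_zero' := RatFunc.eval_zero _ _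
  map_mul' p q := RatFunc.eval_mul _ _ (eval₂_evalPt_ne_zero C α m p.denom_ne_zero)
    (eval₂_evalPt_ne_zero C α m q.denom_ne_zero)
  map_add' p q := RatFunc.eval_add _ _ (eval₂_evalPt_ne_zero C α m p.denom_ne_zero)
    (eval₂_evalPt_ne_zero C α m q.denom_ne_zero)

theorem evalHom_apply (α : Cbar C) (m : ℤ) (p : RatFunc C) :
    evalHom C α m p = evalAt C α m p := rfl

theorem polyσ_apply (p : Polynomial C) : polyσ C p = p.comp (X + 1) := by
  change p.comp (X + Polynomial.C 1) = _
  simp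

theorem ratσ_toRat (p : Polynomial C) : ratσ C (toRat C p) = toRat C (polyσ C p) := by
  have h := RatFunc.map_apply_div_ne_zero (polyσ C : Polynomial C →+* Polynomial C)
    (by
      intro p hp
      simp only [Submonoid.mem_comap]
      refine mem_nonZeroDivisors_iff_ne_zero.mpr ?_
      have hp0 : p ≠ 0 := mem_nonZeroDivisors_iff_ne_zero.mp hp
      simpa using (map_ne_zero_iff _ (polyσ C).injective).mpr hp0) p 1 one_ne_zero
  simpa [ratσ, RatFunc.coe_mapRingHom_eq_coe_map] using h

theorem ratσ_surjective : Function.Surjective (ratσ C) := by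
  intro f
  induction f using RatFunc.induction_on with
  | f p q hq =>
    refine ⟨toRat C ((polyσ C).symm p) / toRat C ((polyσ C).symm q), ?_⟩
    rw [map_div₀, ratσ_toRat, ratσ_toRat]
    simp

theorem evalAt_sub_one (α : Cbar C) (m : ℤ) (p : RatFunc C) :
    evalAt C (α - 1) m p = evalAt C α (m - 1) p := by
  unfold evalAt
  congr 1
  rw [map_sub, map_one, Int.cast_sub, Int.cast_one]
  ring

theorem evalAt_ratσ (α : Cbar C) (m : ℤ) (f : RatFunc C) :
    evalAt C (α - 1) m (ratσ C f) = evalAt C α m f := by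
  have hpt : evalPt C (α - 1) m + 1 = evalPt C α m := by
    rw [evalPt, evalPt, map_sub, map_one]; ring
  induction f using RatFunc.induction_on with
  | f p q hq =>
    simp only [← evalHom_apply, map_div₀, ratσ_toRat]
    simp only [evalHom_apply, evalAt_toRat, polyσ_apply, Polynomial.eval₂_comp]
    simp [hpt]

theorem inLocalRing_ratσ {α : Cbar C} {f : RatFunc C} :
    InLocalRing C (α - 1) (ratσ C f) ↔ InLocalRing C α f := by
  have key (q : Polynomial C) : aeval (α - 1) (polyσ C q) = aeval α q := by
    rw [polyσ_apply, Polynomial.aeval_comp]; simp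
  constructor
  · rintro ⟨p, q, hq, h⟩
    refine ⟨(polyσ C).symm p, (polyσ C).symm q, ?_, (ratσ C).injective ?_⟩
    · rwa [← key, RingEquiv.apply_symm_apply]
    · rw [h, map_div₀, ratσ_toRat, ratσ_toRat, RingEquiv.apply_symm_apply,
        RingEquiv.apply_symm_apply]
  · rintro ⟨p, q, hq, rfl⟩
    exact ⟨polyσ C p, polyσ C q, by rwa [key], by rw [map_div₀, ratσ_toRat, ratσ_toRat]⟩

theorem shift_mem_solSet {α : Cbar C} {b : ℤ → LS C} (hb : b ∈ SolSet C ℓ r α) :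
    (fun n => b (n - 1)) ∈ SolSet C ℓ r (α - 1) := by
  intro n
  have h := hb (n - 1)
  simpa only [evalAt_sub_one, sub_add_eq_add_sub] using h

theorem unshift_mem_solSet {α : Cbar C} {b : ℤ → LS C} (hb : b ∈ SolSet C ℓ r (α - 1)) :
    (fun n => b (n + 1)) ∈ SolSet C ℓ r α := by
  intro n
  have h := hb (n + 1)
  simpa only [evalAt_sub_one, add_sub_cancel_right, add_right_comm] using h

theorem elemApply_Smap (hr0 : ℓ r ≠ 0) {α : Cbar C} {b : ℤ → LS C}
    (hb : b ∈ SolSet C ℓ r (α - 1)) (f : Fin r → RatFunc C) :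
    elemApply C r (α - 1) (Smap C ℓ r f) b 0 = elemApply C r α f (fun n => b (n + 1)) 0 := by
  obtain ⟨s, rfl⟩ : ∃ s, r = s + 1 := Nat.exists_eq_succ_of_ne_zero (NeZero.ne r)
  have h0 := hb 0
  rw [Finset.sum_range_succ, Finset.sum_range] at h0
  have hE : evalAt C (α - 1) 0 (toRat C (ℓ (s + 1))) ≠ 0 := by
    rw [evalAt_toRat]; exact eval₂_evalPt_ne_zero C _ _ hr0
  have hlast : lastIdx (s + 1) = Fin.last s := rfl
  have hS (j : Fin (s + 1)) : evalAt C (α - 1) 0 (Smap C ℓ (s + 1) f j) =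
      (if (j : ℕ) = 0 then 0 else
        evalAt C α 0 (f ⟨(j : ℕ) - 1, lt_of_le_of_lt (Nat.sub_le _ _) j.isLt⟩)) -
      evalAt C α 0 (f (Fin.last s)) * (evalAt C (α - 1) 0 (toRat C (ℓ j)) /
        evalAt C (α - 1) 0 (toRat C (ℓ (s + 1)))) := by
    rw [Smap, hlast, ← evalHom_apply, map_sub, map_mul, map_div₀]
    simp only [apply_ite (evalHom C (α - 1) 0), map_zero, evalHom_apply, evalAt_ratσ]
  have hsum : ∑ j : Fin (s + 1), evalAt C α 0 (f (Fin.last s)) *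
      (evalAt C (α - 1) 0 (toRat C (ℓ j)) / evalAt C (α - 1) 0 (toRat C (ℓ (s + 1)))) *
        b (0 + (j : ℤ)) = - (evalAt C α 0 (f (Fin.last s)) * b (0 + ((s + 1 : ℕ) : ℤ))) := by
    have h1 := eq_neg_of_add_eq_zero_left h0
    calc _ = evalAt C α 0 (f (Fin.last s)) / evalAt C (α - 1) 0 (toRat C (ℓ (s + 1))) *
          ∑ j : Fin (s + 1), evalAt C (α - 1) 0 (toRat C (ℓ j)) * b (0 + ((j : ℕ) : ℤ)) := by
          rw [Finset.mul_sum]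
          refine Finset.sum_congr rfl fun j _ => ?_
          ring
      _ = _ := by
          rw [h1]
          field_simp
  simp only [elemApply, hS, sub_mul, Finset.sum_sub_distrib]
  rw [hsum, sub_neg_eq_add, Fin.sum_univ_succ, Fin.sum_univ_castSucc]
  simp [Fin.castSucc, Fin.castAdd, Fin.castLE]

theorem valAt_Smap (hr0 : ℓ r ≠ 0) (α : Cbar C) (f : Fin r → RatFunc C) :
    valAt C ℓ r (α - 1) (Smap C ℓ r f) = valAt C ℓ r α f := by
  have key {b : ℤ → LS C} (hb : b ∈ SolSet C ℓ r (α - 1)) :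
      esub (nuq C (elemApply C r (α - 1) (Smap C ℓ r f) b 0))
        (liminf (fun n : ℕ => nuq C (b (-(n : ℤ)))) atTop) =
      esub (nuq C (elemApply C r α f (fun n => b (n + 1)) 0))
        (liminf (fun n : ℕ => nuq C (b (-(n : ℤ) + 1))) atTop) := by
    rw [elemApply_Smap C ℓ r hr0 hb,
      ← Filter.liminf_nat_add (fun n : ℕ => nuq C (b (-(n : ℤ) + 1))) 1]
    simp
  refine le_antisymm (le_iInf₂ fun b hb => ?_) (le_iInf₂ fun b hb => ?_)
  · refine iInf₂_le_of_le _ (shift_mem_solSet C ℓ r hb) ?_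
    rw [key (shift_mem_solSet C ℓ r hb)]
    simp
  · rw [key hb]
    exact iInf₂_le _ (unshift_mem_solSet C ℓ r hb)

theorem integralAt_Smap (hr0 : ℓ r ≠ 0) {α : Cbar C} {f : Fin r → RatFunc C} :
    IntegralAt C ℓ r (α - 1) (Smap C ℓ r f) ↔ IntegralAt C ℓ r α f := by
  rw [IntegralAt, IntegralAt, valAt_Smap C ℓ r hr0]

/-- The action of `S` on `A` as a semilinear map over the shift `σ`. -/
def SmapHom : (Fin r → RatFunc C) →ₛₗ[ratσ C] (Fin r → RatFunc C) where
  toFun := Smap C ℓ r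
  map_add' f g := by
    ext1 j
    simp only [Smap, Pi.add_apply, map_add]
    split_ifs <;> ring
  map_smul' c f := by
    ext1 j
    simp only [Smap, Pi.smul_apply, smul_eq_mul, map_mul]
    split_ifs <;> ring

theorem SmapHom_apply (f : Fin r → RatFunc C) :
    SmapHom C ℓ r f = Smap C ℓ r f := rfl

theorem Smap_sum_smul (c : Fin r → RatFunc C) (W : Fin r → (Fin r → RatFunc C)) :
    Smap C ℓ r (∑ i, c i • W i) = ∑ i, ratσ C (c i) • Smap C ℓ r (W i) := by
  simp only [← SmapHom_apply, map_sum, map_smulₛₗ]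

theorem Smap_injective (h0 : ℓ 0 ≠ 0) (hr0 : ℓ r ≠ 0) :
    Function.Injective (Smap C ℓ r) := by
  change Function.Injective (SmapHom C ℓ r)
  refine (injective_iff_map_eq_zero _).mpr fun f hf => ?_
  have hf' (j : Fin r) : Smap C ℓ r f j = 0 := congrFun hf j
  have e0 : toRat C (ℓ 0) ≠ 0 := RatFunc.algebraMap_ne_zero h0
  have er : toRat C (ℓ r) ≠ 0 := RatFunc.algebraMap_ne_zero hr0
  have hl : ratσ C (f (lastIdx r)) = 0 := by
    have := hf' ⟨0, Nat.pos_of_ne_zero (NeZero.ne r)⟩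
    simpa [Smap, e0, er, -map_eq_zero] using this
  funext k
  refine (ratσ C).injective ?_
  rw [Pi.zero_apply, map_zero]
  by_cases hk : (k : ℕ) + 1 < r
  · simpa [Smap, hl, -map_eq_zero] using hf' ⟨k + 1, hk⟩
  · have : k = lastIdx r := by
      ext; simp only [lastIdx]; omega
    rw [this, hl]

theorem Smap_surjective (h0 : ℓ 0 ≠ 0) (hr0 : ℓ r ≠ 0) :
    Function.Surjective (Smap C ℓ r) := by
  intro g
  have e0 : toRat C (ℓ 0) ≠ 0 := RatFunc.algebraMap_ne_zero h0
  have er : toRat C (ℓ r) ≠ 0 := RatFunc.algebraMap_ne_zero hr0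
  have hpos : 0 < r := Nat.pos_of_ne_zero (NeZero.ne r)
  set s : RatFunc C := -(g ⟨0, hpos⟩ * (toRat C (ℓ r) / toRat C (ℓ 0))) with hs
  choose f hf using fun k : Fin r => ratσ_surjective C
    (if h : (k : ℕ) + 1 < r then
      g ⟨k + 1, h⟩ + s * (toRat C (ℓ (k + 1)) / toRat C (ℓ r)) else s)
  have hl : ratσ C (f (lastIdx r)) = s := by
    rw [hf, dif_neg]; simp only [lastIdx]; omega
  refine ⟨f, funext fun j => ?_⟩
  rw [Smap, hl]
  obtain ⟨j, hj⟩ := j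
  rcases j with _ | j
  · rw [if_pos rfl, hs]
    field_simp
    ring
  · simp [hf, hj]

theorem IsVSBasis.Smap (h0 : ℓ 0 ≠ 0) (hr0 : ℓ r ≠ 0)
    {W : Fin r → (Fin r → RatFunc C)} (hW : IsVSBasis C r W) :
    IsVSBasis C r (fun i => Smap C ℓ r (W i)) := by
  have hli : LinearIndependent (RatFunc C) (fun i => PRec.Smap C ℓ r (W i)) := by
    rw [Fintype.linearIndependent_iff]
    intro c hc i
    choose d hd using fun i => ratσ_surjective C (c i)
    simp only [← hd] at hc
    rw [← Smap_sum_smul, ← SmapHom_apply, ← map_zero (SmapHom C ℓ r)] at hc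
    have := Fintype.linearIndependent_iff.mp hW.1 d (Smap_injective C ℓ r h0 hr0 hc) i
    rw [← hd, this, map_zero]
  exact ⟨hli, hli.span_eq_top_of_card_eq_finrank (by simp)⟩

theorem statement6 [NeZero r] (hr : 1 ≤ r) (hℓ : ℓ 0 * ℓ r ≠ 0) (α : Cbar C)
    (W : Fin r → (Fin r → RatFunc C)) (hW : IsVSBasis C r W) :
    IsLocalIntegralBasis C ℓ r α W ↔
      IsLocalIntegralBasis C ℓ r (α - 1) (fun i => Smap C ℓ r (W i)) := by
  have h0 : ℓ 0 ≠ 0 := left_ne_zero_of_mul hℓ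
  have hr0 : ℓ r ≠ 0 := right_ne_zero_of_mul hℓ
  constructor
  · rintro ⟨-, hint, hgen⟩
    refine ⟨hW.Smap C ℓ r h0 hr0, fun i => (integralAt_Smap C ℓ r hr0).mpr (hint i), ?_⟩
    intro f hf
    obtain ⟨g, rfl⟩ := Smap_surjective C ℓ r h0 hr0 f
    obtain ⟨c, hc, rfl⟩ := hgen g ((integralAt_Smap C ℓ r hr0).mp hf)
    exact ⟨fun i => ratσ C (c i), fun i => (inLocalRing_ratσ C).mpr (hc i),
      Smap_sum_smul C ℓ r c W⟩
  · rintro ⟨-, hint, hgen⟩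
    refine ⟨hW, fun i => (integralAt_Smap C ℓ r hr0).mp (hint i), ?_⟩
    intro f hf
    obtain ⟨c, hc, hfc⟩ := hgen _ ((integralAt_Smap C ℓ r hr0).mpr hf)
    choose d hd using fun i => ratσ_surjective C (c i)
    refine ⟨d, fun i => (inLocalRing_ratσ C).mp (hd i ▸ hc i), Smap_injective C ℓ r h0 hr0 ?_⟩
    rw [hfc, Smap_sum_smul]
    simp only [hd]

end PRec
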